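/- arXiv:2108.06967 — 5 statements merged into one kernel-verified Lean document; each statement's English description precedes it below -/
import Mathlib

section
/- Let n ≥ 3 be an odd integer with n = 1 + r·q, where q is an odd prime and r is an even positive integer with r < q. If there exists an integer a satisfying a^(n−1) ≡ 1 (mod n) and gcd(a^r − 1, n) = 1, then n is prime. -/
/-- If `x ^ (r * q) = 1` and `x ^ r ≠ 1` in `ZMod p`, for primes `p` and `q`,
then `q ∣ p - 1`. -/
theorem dvd_prime_sub_one_of_pow_mul_eq_one {p q r : ℕ} [Fact p.Prime] (hq : q.Prime)
    {x : ZMod p} (h : x ^ (r * q) = 1) (hne : x ^ r ≠ 1) : q ∣ p - 1 := by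
  have : Fact q.Prime := ⟨hq⟩
  rw [pow_mul] at h
  rw [← orderOf_eq_prime h hne]
  refine orderOf_dvd_of_pow_eq_one (ZMod.pow_card_sub_one_eq_one fun h0 => ?_)
  simp [h0, hq.ne_zero] at h

/-- Pocklington-type primality criterion (Proposition 1, first part):
if `n ≥ 3` is odd, `n = 1 + r·q` with `q` an odd prime, `r` even, `0 < r < q`,
and some integer `a` satisfies `a^(n-1) ≡ 1 (mod n)` and `gcd(a^r - 1, n) = 1`,
then `n` is prime. -/
theorem stmt0 (n q r : ℕ) (hn3 : 3 ≤ n) (hnodd : Odd n)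
    (hq : Nat.Prime q) (hqodd : Odd q)
    (hrpos : 0 < r) (hreven : Even r) (hrq : r < q)
    (hn : n = 1 + r * q)
    (a : ℤ) (ha1 : Int.ModEq (n : ℤ) (a ^ (n - 1)) 1)
    (ha2 : Int.gcd (a ^ r - 1) (n : ℤ) = 1) :
    Nat.Prime n := by
  by_contra hnp
  have hp : n.minFac.Prime := Nat.minFac_prime (by omega)
  have : Fact n.minFac.Prime := ⟨hp⟩
  have hpn : (n.minFac : ℤ) ∣ n := by exact_mod_cast n.minFac_dvd
  have hpow : (a : ZMod n.minFac) ^ (r * q) = 1 := by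
    have h := (ZMod.intCast_eq_intCast_iff _ _ _).2 (ha1.of_dvd hpn)
    rw [show n - 1 = r * q by omega] at h
    exact_mod_cast h
  have hne : (a : ZMod n.minFac) ^ r ≠ 1 := by
    intro h
    have hdvd : (n.minFac : ℤ) ∣ a ^ r - 1 := by
      rw [← ZMod.intCast_zmod_eq_zero_iff_dvd]
      push_cast
      rw [h, sub_self]
    have hgcd := Int.dvd_coe_gcd hdvd hpn
    rw [ha2] at hgcd
    exact hp.one_lt.ne' (Nat.dvd_one.1 (by exact_mod_cast hgcd))
  have hle := Nat.le_of_dvd (by have := hp.two_le; omega)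
    (dvd_prime_sub_one_of_pow_mul_eq_one hq hpow hne)
  have hsq := Nat.minFac_sq_le_self (by omega) hnp
  have hlt : q + 1 ≤ n.minFac := by have := hp.two_le; omega
  nlinarith [Nat.pow_le_pow_left hlt 2, Nat.mul_le_mul_right q hrq.le, hq.pos]
end

section
/- Let G be a commutative group, let m ∈ G with m^d = 1 for a positive integer d, and let t = d − 1 (with d ≥ 2). Let v_1, …, v_w ∈ G and positive integers s_1, …, s_w with v_j^(s_j) = 1 for each j. Set s = s_1·s_2⋯s_w and suppose s divides t. Then ((v_1·v_2⋯v_w) · m^(t/s))^s = m⁻¹. -/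
/-- Correctness of Version 1 of the secret sharing scheme in the case
`d = t + 1`, i.e. `t = d - 1` (with `d ≥ 2`): with `m^d = 1`, shares
`s 1, …, s w` with `v j ^ (s j) = 1` and `S = s 1 ⋯ s w` dividing `t`,
the coalition obtains `((v 1 ⋯ v w) · m^(t/S))^S = m⁻¹`. -/
theorem stmt6 {G : Type*} [CommGroup G] (m : G) (d : ℕ) (hd : 2 ≤ d)
    (hm : m ^ d = 1) (t : ℕ) (ht : t = d - 1)
    (w : ℕ) (v : ℕ → G) (s : ℕ → ℕ)
    (hspos : ∀ j ∈ Finset.Icc 1 w, 0 < s j)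
    (hv : ∀ j ∈ Finset.Icc 1 w, v j ^ s j = 1)
    (S : ℕ) (hS : S = ∏ j ∈ Finset.Icc 1 w, s j) (hdvd : S ∣ t) :
    ((∏ j ∈ Finset.Icc 1 w, v j) * m ^ (t / S)) ^ S = m⁻¹ := by
  have hprod : (∏ j ∈ Finset.Icc 1 w, v j) ^ S = 1 := by
    rw [← Finset.prod_pow]
    refine Finset.prod_eq_one fun j hj => ?_
    obtain ⟨k, hk⟩ : s j ∣ S := hS ▸ Finset.dvd_prod_of_mem s hj
    rw [hk, pow_mul, hv j hj, one_pow]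
  rw [mul_pow, hprod, one_mul, ← pow_mul, Nat.div_mul_cancel hdvd]
  refine eq_inv_of_mul_eq_one_left ?_
  rw [← pow_succ, ht, Nat.sub_add_cancel (by lia), hm]
end

section
/- For every n ∈ ℕ with n ≥ 1 and every k with 1 ≤ k ≤ n, there exist a nonempty finite set T and subsets T_1, …, T_n of T such that the union of any k of the subsets T_j equals T, while the union of any fewer than k of them is a proper subset of T. -/
/-- Lemma 1: for every `n ≥ 1` and `1 ≤ k ≤ n` there is a nonempty finite
set `T` together with `n` subsets `Tsub 1, …, Tsub n ⊆ T` such that the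
union of any `k` of the subsets equals `T`, while the union of any fewer
than `k` of them is a proper subset of `T`. -/
theorem stmt9 (n k : ℕ) (hn : 1 ≤ n) (hk1 : 1 ≤ k) (hkn : k ≤ n) :
    ∃ (T : Finset (Finset (Fin n))) (Tsub : Fin n → Finset (Finset (Fin n))),
      T.Nonempty ∧ (∀ j, Tsub j ⊆ T) ∧
      (∀ S : Finset (Fin n), S.card = k → S.biUnion Tsub = T) ∧
      (∀ S : Finset (Fin n), S.card < k → S.biUnion Tsub ⊂ T) := by
  refine ⟨Finset.powersetCard (k - 1) Finset.univ,
    fun j => (Finset.powersetCard (k - 1) Finset.univ).filter (j ∉ ·), ?_,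
    fun j => Finset.filter_subset _ _, fun S hS => ?_, fun S hS => ?_⟩
  · rw [Finset.powersetCard_nonempty, Finset.card_univ, Fintype.card_fin]
    omega
  · refine (Finset.biUnion_subset.2 fun j _ => Finset.filter_subset _ _).antisymm fun A hA => ?_
    have hcard : A.card < S.card := by
      rw [(Finset.mem_powersetCard.1 hA).2]
      omega
    obtain ⟨j, hjS, hjA⟩ := Finset.exists_mem_notMem_of_card_lt_card hcard
    exact Finset.mem_biUnion.2 ⟨j, hjS, Finset.mem_filter.2 ⟨hA, hjA⟩⟩
  · obtain ⟨A, hSA, -, hA⟩ := Finset.exists_subsuperset_card_eq (n := k - 1)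
      (Finset.subset_univ S) (by omega) (by rw [Finset.card_univ, Fintype.card_fin]; omega)
    refine (Finset.ssubset_iff_of_subset
      (Finset.biUnion_subset.2 fun j _ => Finset.filter_subset _ _)).2
      ⟨A, Finset.mem_powersetCard.2 ⟨Finset.subset_univ A, hA⟩, fun h => ?_⟩
    obtain ⟨j, hjS, hj⟩ := Finset.mem_biUnion.1 h
    exact (Finset.mem_filter.1 hj).2 (hSA hjS)
end

section
/- Fix integers n ≥ 1 and 1 ≤ k ≤ n. For j ∈ {1, …, n} define T_j to be the collection of all subsets V of {1, …, n} with |V| ≤ k − 1 and j ∉ V, as a subset of the set T of all subsets V of {1, …, n} with |V| ≤ k − 1. Then for every S ⊆ {1, …, n}: the union ⋃_{j∈S} T_j equals T if and only if |S| ≥ k. -/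
/-- The explicit construction proving Lemma 1: index the shared set `T` by
the subsets `V` of `{1, …, n}` (modelled as `Fin n`) with `|V| ≤ k - 1`,
and give participant `j` the part `Tsub j` consisting of those `V` with
`j ∉ V`. Then a coalition `S ⊆ {1, …, n}` covers `T` iff `|S| ≥ k`. -/
theorem stmt10 (n k : ℕ) (hn : 1 ≤ n) (hk1 : 1 ≤ k) (hkn : k ≤ n)
    (T : Finset (Finset (Fin n)))
    (hT : T = Finset.univ.filter (fun V : Finset (Fin n) => V.card ≤ k - 1))
    (Tsub : Fin n → Finset (Finset (Fin n)))
    (hTsub : ∀ j, Tsub j =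
      Finset.univ.filter (fun V : Finset (Fin n) => V.card ≤ k - 1 ∧ j ∉ V))
    (S : Finset (Fin n)) :
    S.biUnion Tsub = T ↔ k ≤ S.card := by
  subst hT
  constructor
  · intro h
    by_contra! hlt
    have hS : S ∈ S.biUnion Tsub := by
      rw [h, Finset.mem_filter]
      exact ⟨Finset.mem_univ S, by omega⟩
    obtain ⟨j, hj, hjS⟩ := Finset.mem_biUnion.mp hS
    rw [hTsub, Finset.mem_filter] at hjS
    exact hjS.2.2 hj
  · intro hkS
    ext V
    simp only [Finset.mem_biUnion, hTsub, Finset.mem_filter, Finset.mem_univ, true_and]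
    constructor
    · rintro ⟨j, -, hV, -⟩
      exact hV
    · intro hV
      obtain ⟨j, hjS, hjV⟩ := Finset.exists_mem_notMem_of_card_lt_card
        (show V.card < S.card by omega)
      exact ⟨j, hjS, hV, hjV⟩
end

section
/- Let G be a commutative monoid and d a positive integer. Let I be a finite index set, and for each i ∈ I let v_i ∈ G and t_i a positive integer with v_i^(t_i) = 1; let m ∈ G with m^d = 1. Let T_1, …, T_n be subsets of I and for each j ∈ {1, …, n} let e_j be a positive integer such that e_j ≡ 1 (mod d) and t_i divides e_j for every i ∈ T_j. If S ⊆ {1, …, n} satisfies ⋃_{j∈S} T_j = I, then ((∏_{i∈I} v_i) · m)^(∏_{j∈S} e_j) = m. -/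
/-- Correctness of the (k, n)-threshold scheme of Section 5: the dealer
sends `(∏ i ∈ I, v i) · m` with `v i ^ (t i) = 1` and `m ^ d = 1`;
participant `j` holds the share `e j` with `e j ≡ 1 (mod d)` and
`t i ∣ e j` for every `i ∈ T j`. Any coalition `S` whose index sets
jointly cover `I` recovers `m` by raising the ciphertext to the product of
its shares. -/
theorem stmt12 {G : Type*} [CommMonoid G] {ι : Type*} [DecidableEq ι]
    (d : ℕ) (hd : 0 < d) (m : G) (hm : m ^ d = 1)
    (I : Finset ι) (v : ι → G) (t : ι → ℕ)
    (htpos : ∀ i ∈ I, 0 < t i) (hv : ∀ i ∈ I, v i ^ t i = 1)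
    (n : ℕ) (T : Fin n → Finset ι) (hTI : ∀ j, T j ⊆ I)
    (e : Fin n → ℕ) (hepos : ∀ j, 0 < e j)
    (hed : ∀ j, e j ≡ 1 [MOD d])
    (hdvd : ∀ j, ∀ i ∈ T j, t i ∣ e j)
    (S : Finset (Fin n)) (hcover : S.biUnion T = I) :
    ((∏ i ∈ I, v i) * m) ^ (∏ j ∈ S, e j) = m := by
  have hE : ∏ j ∈ S, e j ≡ 1 [MOD d] :=
    Finset.prod_induction e (· ≡ 1 [MOD d])
      (fun _ _ ha hb => by simpa using ha.mul hb) rfl (fun j _ => hed j)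
  have hvE : ∀ i ∈ I, v i ^ (∏ j ∈ S, e j) = 1 := by
    intro i hi
    obtain ⟨j, hj, hij⟩ := Finset.mem_biUnion.mp (hcover ▸ hi)
    exact orderOf_dvd_iff_pow_eq_one.mp <| (orderOf_dvd_of_pow_eq_one (hv i hi)).trans <|
      (hdvd j i hij).trans (Finset.dvd_prod_of_mem e hj)
  rw [mul_pow, ← Finset.prod_pow, Finset.prod_eq_one hvE, one_mul,
    pow_eq_pow_of_modEq hE hm, pow_one]
end
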